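/- arXiv:2507.02688 — 2 statements merged into one kernel-verified Lean document; each statement's English description precedes it below -/
import Mathlib

section
/- Let R be a commutative ring, π ∈ R, and let φ : N → N′ be an R-module homomorphism whose kernel and cokernel are both finite. Then the induced R-module homomorphism ψ : N/πN → N′/πN′ also has finite kernel and finite cokernel; moreover the cardinality of coker(ψ) is at most the cardinality of coker(φ). -/
theorem Submodule.mem_span_singleton_smul_top_iff {R M : Type*} [CommRing R] [AddCommGroup M]
    [Module R M] (r : R) (x : M) :
    x ∈ Ideal.span {r} • (⊤ : Submodule R M) ↔ ∃ y : M, r • y = x := by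
  rw [Submodule.ideal_span_singleton_smul, Submodule.mem_smul_pointwise_iff_exists]
  simp

/-- A linear map with finite kernel and cokernel has only finitely many classes modulo `r` that it
sends into the multiples of `r`. -/
theorem LinearMap.finite_mk_image_setOf_eq_smul {R M M' : Type*} [CommRing R] [AddCommGroup M]
    [Module R M] [AddCommGroup M'] [Module R M'] (r : R) (φ : M →ₗ[R] M')
    [Finite (LinearMap.ker φ)] [Finite (M' ⧸ LinearMap.range φ)] :
    ((Submodule.mkQ (Ideal.span {r} • (⊤ : Submodule R M))) '' {x | ∃ y, r • y = φ x}).Finite := by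
  have hrep (c : M' ⧸ LinearMap.range φ) : ∃ x₀ : M, ∀ x y, r • y = φ x →
      (LinearMap.range φ).mkQ y = c →
      ∃ y₀, r • y₀ = φ x₀ ∧ (LinearMap.range φ).mkQ y₀ = c := by
    by_cases h : ∃ x y, r • y = φ x ∧ (LinearMap.range φ).mkQ y = c
    · obtain ⟨x₀, h₀⟩ := h
      exact ⟨x₀, fun _ _ _ _ => h₀⟩
    · exact ⟨0, fun x y hx hy => (h ⟨x, y, hx, hy⟩).elim⟩
  choose f hf using hrep
  refine (Set.finite_range fun p : (M' ⧸ LinearMap.range φ) × LinearMap.ker φ =>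
    (Submodule.mkQ (Ideal.span {r} • (⊤ : Submodule R M))) (f p.1 + p.2)).subset ?_
  rintro _ ⟨x, ⟨y, hy⟩, rfl⟩
  obtain ⟨y₀, hy₀, hc⟩ := hf _ x y hy rfl
  obtain ⟨z, hz⟩ := (Submodule.Quotient.eq _).1 hc
  refine ⟨((LinearMap.range φ).mkQ y, ⟨x - f ((LinearMap.range φ).mkQ y) + r • z, ?_⟩), ?_⟩
  · rw [LinearMap.mem_ker, map_add, map_sub, map_smul, hz, ← hy, ← hy₀, smul_sub]
    abel
  · refine (Submodule.Quotient.eq _).2 ((Submodule.mem_span_singleton_smul_top_iff r _).2 ⟨z, ?_⟩)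
    dsimp only
    abel

/-- **Lemma 4.5.** Let `R` be a commutative ring, `π ∈ R`, and let `φ : N → N′` be an
`R`-module homomorphism whose kernel and cokernel are both finite. Then the induced map
`ψ : N/πN → N′/πN′` (characterized by `ψ (x mod πN) = φ x mod πN′`) also has finite kernel
and finite cokernel; moreover `#coker(ψ) ≤ #coker(φ)`. -/
theorem stmt1 (R : Type*) [CommRing R] (π : R)
    (N N' : Type*) [AddCommGroup N] [Module R N] [AddCommGroup N'] [Module R N']
    (φ : N →ₗ[R] N')
    (hker : Finite (LinearMap.ker φ)) (hcoker : Finite (N' ⧸ LinearMap.range φ)) :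
    ∃ ψ : (N ⧸ (Ideal.span {π} • (⊤ : Submodule R N))) →ₗ[R]
          (N' ⧸ (Ideal.span {π} • (⊤ : Submodule R N'))),
      (∀ x : N, ψ (Submodule.Quotient.mk x) = Submodule.Quotient.mk (φ x)) ∧
      Finite (LinearMap.ker ψ) ∧
      Finite ((N' ⧸ (Ideal.span {π} • (⊤ : Submodule R N'))) ⧸ LinearMap.range ψ) ∧
      Nat.card ((N' ⧸ (Ideal.span {π} • (⊤ : Submodule R N'))) ⧸ LinearMap.range ψ) ≤
        Nat.card (N' ⧸ LinearMap.range φ) := by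
  have hle : Ideal.span {π} • (⊤ : Submodule R N) ≤
      (Ideal.span {π} • (⊤ : Submodule R N')).comap φ := by
    intro x hx
    obtain ⟨y, rfl⟩ := (Submodule.mem_span_singleton_smul_top_iff π x).1 hx
    exact (Submodule.mem_span_singleton_smul_top_iff π _).2 ⟨φ y, (map_smul φ π y).symm⟩
  set ψ := Submodule.mapQ _ _ φ hle
  have hsurj : ∃ g : (N' ⧸ LinearMap.range φ) →ₗ[R] (_ ⧸ LinearMap.range ψ),
      Function.Surjective g := by
    refine ⟨Submodule.mapQ _ _ (Submodule.mkQ _) ?_, ?_⟩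
    · rintro _ ⟨x, rfl⟩
      exact ⟨Submodule.Quotient.mk x, rfl⟩
    · intro q
      obtain ⟨q, rfl⟩ := Submodule.mkQ_surjective _ q
      obtain ⟨y, rfl⟩ := Submodule.mkQ_surjective _ q
      exact ⟨Submodule.Quotient.mk y, rfl⟩
  obtain ⟨g, hg⟩ := hsurj
  refine ⟨ψ, fun _ => rfl, ?_, Finite.of_surjective g hg, Nat.card_le_card_of_surjective g hg⟩
  refine ((LinearMap.finite_mk_image_setOf_eq_smul π φ).subset fun q hq => ?_).to_subtype
  obtain ⟨x, rfl⟩ := Submodule.mkQ_surjective _ q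
  exact ⟨x, (Submodule.mem_span_singleton_smul_top_iff π _).1
    ((Submodule.Quotient.mk_eq_zero _).1 hq), rfl⟩
end

section
/- Let p be a prime, λ ≥ 0 a natural number, X a ℤ_p-module, and φ : X → ℤ_p^λ a ℤ_p-linear map with finite kernel and finite cokernel. Then there is a ℤ_p-module isomorphism X ≅ ℤ_p^λ ⊕ ker(φ), and in particular X/pX is finite. -/
/-- A finite module over a domain of characteristic zero has rank zero. -/
theorem finrank_eq_zero_of_finite_of_charZero (R M : Type*) [CommRing R] [IsDomain R] [CharZero R]
    [AddCommGroup M] [Module R M] [Finite M] : Module.finrank R M = 0 := by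
  rw [Module.finrank_eq_zero_iff]
  refine fun x => ⟨(Nat.card M : R), Nat.cast_ne_zero.mpr Nat.card_pos.ne', ?_⟩
  rw [Nat.cast_smul_eq_nsmul, card_nsmul_eq_zero']

/-- A submodule of finite index in a finite free module over a principal ideal domain of
characteristic zero is isomorphic to the whole module. -/
theorem Submodule.nonempty_linearEquiv_of_finite_quotient {R M : Type*} [CommRing R] [IsDomain R]
    [IsPrincipalIdealRing R] [CharZero R] [AddCommGroup M] [Module R M] [Module.Free R M]
    [Module.Finite R M] (N : Submodule R M) [Finite (M ⧸ N)] : Nonempty (N ≃ₗ[R] M) := by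
  have h := N.finrank_quotient_add_finrank
  rw [finrank_eq_zero_of_finite_of_charZero, zero_add] at h
  exact ⟨LinearEquiv.ofFinrankEq N M h⟩

/-- A linear map with projective range splits off its kernel. -/
theorem LinearMap.nonempty_linearEquiv_range_prod_ker {R M N : Type*} [CommRing R]
    [AddCommGroup M] [Module R M] [AddCommGroup N] [Module R N] (f : M →ₗ[R] N)
    [Module.Projective R (LinearMap.range f)] :
    Nonempty (M ≃ₗ[R] LinearMap.range f × LinearMap.ker f) := by
  obtain ⟨s, hs⟩ := f.rangeRestrict.exists_rightInverse_of_surjective f.range_rangeRestrict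
  have hexact : Function.Exact (LinearMap.ker f).subtype f.rangeRestrict := by
    rw [LinearMap.exact_iff, f.ker_rangeRestrict, Submodule.range_subtype]
  exact ⟨(hexact.splitSurjectiveEquiv (LinearMap.ker f).injective_subtype ⟨s, hs⟩).1.trans
    (LinearEquiv.prodComm R _ _)⟩

theorem PadicInt.finite_quotient_span_p (p : ℕ) [Fact p.Prime] :
    Finite (ℤ_[p] ⧸ Ideal.span {(p : ℤ_[p])}) := by
  rw [← PadicInt.maximalIdeal_eq_span_p]
  exact Finite.of_equiv (ZMod p) PadicInt.residueField.symm.toEquiv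

/-- **Theorem 3.12 (module-theoretic content).** Let `p` be a prime, `λ ≥ 0`, `X` a
`ℤ_p`-module, and `φ : X → ℤ_p^λ` a `ℤ_p`-linear map with finite kernel and finite
cokernel. Then `X ≅ ℤ_p^λ ⊕ ker(φ)` as `ℤ_p`-modules, and in particular `X/pX` is finite. -/
theorem stmt5 (p : ℕ) [Fact p.Prime] (lam : ℕ)
    (X : Type*) [AddCommGroup X] [Module ℤ_[p] X]
    (φ : X →ₗ[ℤ_[p]] (Fin lam → ℤ_[p]))
    (hker : Finite (LinearMap.ker φ))
    (hcoker : Finite ((Fin lam → ℤ_[p]) ⧸ LinearMap.range φ)) :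
    Nonempty (X ≃ₗ[ℤ_[p]] ((Fin lam → ℤ_[p]) × LinearMap.ker φ)) ∧
    Finite (X ⧸ (Ideal.span {(p : ℤ_[p])} • (⊤ : Submodule ℤ_[p] X))) := by
  obtain ⟨e⟩ := φ.nonempty_linearEquiv_range_prod_ker
  obtain ⟨e'⟩ := (LinearMap.range φ).nonempty_linearEquiv_of_finite_quotient
  have E := e.trans (e'.prodCongr (LinearEquiv.refl ℤ_[p] (LinearMap.ker φ)))
  have : Module.Finite ℤ_[p] X := Module.Finite.equiv E.symm
  have := PadicInt.finite_quotient_span_p p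
  exact ⟨⟨E⟩, Submodule.finite_quotient_smul _ Module.Finite.fg_top⟩
end
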